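/- Let L ≥ 1, a ≥ 0, b ≥ 0 be integers. Let r_{i,j} ∈ ℂ for 1 ≤ i ≤ a, 1 ≤ j ≤ L+a, and s_{i,j} ∈ ℂ for 1 ≤ i ≤ b, 1 ≤ j ≤ L+b, be constants, and let R_1,…,R_{L+a} : ℂ → ℂ and S_1,…,S_{L+b} : ℂ → ℂ be measurable functions such that each product R_i·S_j is Lebesgue-integrable over ℂ and such that the L-fold integral J = ∫_{ℂ^L} det[ first a rows: r_{i,j}; next L rows: R_j(w_i) ]_{(L+a)×(L+a)} · det[ first b rows: s_{i,j}; next L rows: S_j(w_i) ]_{(L+b)×(L+b)} dw_1⋯dw_L converges absolutely. Then J = (−1)^{ab} · L! · det[ M ], where M is the (L+a+b)×(L+a+b) matrix with: upper-left b×a block identically zero; upper-right block entries s_{i,j} for 1 ≤ i ≤ b, 1 ≤ j ≤ L+b; lower-left block entries r_{j,i} for 1 ≤ i ≤ L+a, 1 ≤ j ≤ a; and lower-right block entries ∫_ℂ R_i(w) S_j(w) dw for 1 ≤ i ≤ L+a, 1 ≤ j ≤ L+b. -/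

import Mathlib

open MeasureTheory Matrix

noncomputable section

open Equiv

/-- There are `(card κ)!` permutations of `α ⊕ κ` with prescribed (injective) values on `α`. -/
theorem card_perm_comp_inl_eq {α κ : Type*} [Fintype α] [Fintype κ] [DecidableEq α]
    [DecidableEq κ] (f : α → α ⊕ κ) (hf : Function.Injective f) :
    (Finset.univ.filter fun σ : Perm (α ⊕ κ) => ⇑σ ∘ Sum.inl = f).card =
      (Fintype.card κ).factorial := by
  classical
  let e₀ : Set.range (Sum.inl : α → α ⊕ κ) ≃ Set.range f :=
    (Equiv.ofInjective _ Sum.inl_injective).symm.trans (Equiv.ofInjective f hf)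
  have he₀ (i : α) : (e₀ ⟨Sum.inl i, i, rfl⟩ : α ⊕ κ) = f i := by
    have h : (Equiv.ofInjective (Sum.inl : α → α ⊕ κ) Sum.inl_injective).symm
        ⟨Sum.inl i, i, rfl⟩ = i := by
      rw [Equiv.symm_apply_eq]; rfl
    simp only [e₀, Equiv.trans_apply, h, Equiv.ofInjective_apply]
  have hcard₁ : Fintype.card ((Set.range (Sum.inl : α → α ⊕ κ))ᶜ : Set (α ⊕ κ)) =
      Fintype.card κ := by
    rw [Fintype.card_compl_set, Set.card_range_of_injective Sum.inl_injective, Fintype.card_sum]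
    omega
  have hcard₂ : Fintype.card ((Set.range f)ᶜ : Set (α ⊕ κ)) = Fintype.card κ := by
    rw [Fintype.card_compl_set, Set.card_range_of_injective hf, Fintype.card_sum]
    omega
  rw [← Fintype.card_subtype, ← hcard₁,
    ← Fintype.card_equiv (Fintype.equivOfCardEq (hcard₁.trans hcard₂.symm)),
    ← Fintype.card_congr (Equiv.Set.compl e₀)]
  refine Fintype.card_congr (Equiv.subtypeEquivRight fun σ => ?_)
  constructor
  · rintro h ⟨_, i, rfl⟩
    rw [he₀, ← h, Function.comp_apply]
  · intro h
    funext i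
    rw [← he₀ i, ← h ⟨Sum.inl i, i, rfl⟩, Function.comp_apply]

/-- Summing over permutations a function of their restriction to `α` that vanishes on
non-injective maps. -/
theorem sum_perm_comp_inl {α κ A : Type*} [Fintype α] [Fintype κ] [DecidableEq α]
    [DecidableEq κ] [AddCommMonoid A] (h : (α → α ⊕ κ) → A)
    (hh : ∀ f, ¬ Function.Injective f → h f = 0) :
    ∑ σ : Perm (α ⊕ κ), h (⇑σ ∘ Sum.inl) = (Fintype.card κ).factorial • ∑ f, h f := by
  rw [← Finset.sum_fiberwise Finset.univ (fun σ : Perm (α ⊕ κ) => ⇑σ ∘ Sum.inl),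
    Finset.smul_sum]
  refine Finset.sum_congr rfl fun f _ => ?_
  rw [Finset.sum_congr rfl fun σ hσ => congrArg h (Finset.mem_filter.1 hσ).2, Finset.sum_const]
  by_cases hf : Function.Injective f
  · rw [card_perm_comp_inl_eq f hf]
  · rw [hh f hf, smul_zero, smul_zero]

section Bordered

variable {α β κ 𝕜 : Type*}

/-- The row of a bordered matrix attached to a vector indexed by `α ⊕ κ`. -/
def borderRow [Zero 𝕜] (x : α ⊕ κ → 𝕜) : α ⊕ (β ⊕ κ) → 𝕜 :=
  Sum.elim (fun i => x (Sum.inl i)) (Sum.elim 0 fun k => x (Sum.inr k))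

/-- The rows below the border `borderRow`. -/
def coreRow (s : β → β ⊕ κ → 𝕜) (K : α ⊕ κ → β ⊕ κ → 𝕜) (j : β ⊕ κ) : α ⊕ (β ⊕ κ) → 𝕜 :=
  Sum.elim (fun i => K (Sum.inl i) j) (Sum.elim (fun b => s b j) fun k => K (Sum.inr k) j)

/-- The kernel `K` bordered by `r` and `s`, arranged as a square matrix. -/
def bordered [Zero 𝕜] (r : α → α ⊕ κ → 𝕜) (s : β → β ⊕ κ → 𝕜) (K : α ⊕ κ → β ⊕ κ → 𝕜) :
    Matrix (α ⊕ (β ⊕ κ)) (α ⊕ (β ⊕ κ)) 𝕜 :=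
  Matrix.of (Sum.elim (fun i => borderRow (r i)) (coreRow s K))

variable [Fintype α] [Fintype β] [Fintype κ] [DecidableEq α] [DecidableEq β] [DecidableEq κ]
  [CommRing 𝕜]

/-- Multilinear expansion of a bordered determinant along its border. -/
theorem det_bordered_eq_sum (r : α → α ⊕ κ → 𝕜) (s : β → β ⊕ κ → 𝕜)
    (K : α ⊕ κ → β ⊕ κ → 𝕜) :
    (bordered r s K).det =
      ∑ f : α → α ⊕ κ, (∏ i, r i (f i)) *
        (bordered (fun i => Pi.single (f i) 1) s K).det := by
  let D := (detRowAlternating (n := α ⊕ (β ⊕ κ)) (R := 𝕜)).toMultilinearMap.currySum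
  have hD (u) (v) : D u v = (Matrix.of (Sum.elim u v)).det := rfl
  have hr : (fun i => borderRow (β := β) (r i)) =
      fun i => ∑ j, r i j • borderRow (β := β) (Pi.single j (1 : 𝕜)) := by
    funext i x
    rcases x with x | x | x <;>
      simp [borderRow, Finset.sum_apply, Pi.single_apply]
  have : (bordered r s K).det = D (fun i => borderRow (r i)) (coreRow s K) := rfl
  rw [this, hr, D.map_sum, _root_.sum_apply]
  refine Finset.sum_congr rfl fun f _ => ?_
  rw [D.map_smul_univ, _root_.smul_apply, smul_eq_mul]
  rfl

theorem det_bordered_single_of_not_injective (f : α → α ⊕ κ) (hf : ¬ Function.Injective f)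
    (s : β → β ⊕ κ → 𝕜) (K : α ⊕ κ → β ⊕ κ → 𝕜) :
    (bordered (fun i => Pi.single (f i) 1) s K).det = 0 := by
  simp only [Function.Injective, not_forall] at hf
  obtain ⟨i, j, hij, hne⟩ := hf
  refine det_zero_of_row_eq (i := Sum.inl i) (j := Sum.inl j) (by simpa using hne) ?_
  funext x
  simp only [bordered, Matrix.of_apply, Sum.elim_inl, hij]

/-- A border of distinct unit vectors deletes the corresponding rows of the kernel. -/
theorem det_bordered_single (σ : Perm (α ⊕ κ)) (s : β → β ⊕ κ → 𝕜)
    (K : α ⊕ κ → β ⊕ κ → 𝕜) :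
    (bordered (fun i => Pi.single (σ (Sum.inl i)) 1) s K).det =
      Perm.sign σ * (Matrix.of (Sum.elim s fun k => K (σ (Sum.inr k)))).det := by
  let E : (α ⊕ κ) ⊕ β ≃ α ⊕ (β ⊕ κ) :=
    (Equiv.sumAssoc α κ β).trans (Equiv.sumCongr (Equiv.refl α) (Equiv.sumComm κ β))
  let p : Perm (α ⊕ (β ⊕ κ)) := E.permCongr (Equiv.Perm.sumCongr σ 1)
  have hrow (x : α ⊕ κ → 𝕜) (y : α ⊕ κ) :
      borderRow (β := β) x (E (Sum.inl y)) = x y := by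
    rcases y with y | y <;> rfl
  have hcore (j : β ⊕ κ) (y : α ⊕ κ) : coreRow s K j (E (Sum.inl y)) = K y j := by
    rcases y with y | y <;> rfl
  have hp₁ (i : α) : p (Sum.inl i) = E (Sum.inl (σ (Sum.inl i))) := rfl
  have hp₂ (b : β) : p (Sum.inr (Sum.inl b)) = Sum.inr (Sum.inl b) := rfl
  have hp₃ (k : κ) : p (Sum.inr (Sum.inr k)) = E (Sum.inl (σ (Sum.inr k))) := rfl
  have hsign : Perm.sign p = Perm.sign σ := by
    simp [p, Perm.sign_permCongr, Perm.sign_sumCongr]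
  have hN : (bordered (fun i => Pi.single (σ (Sum.inl i)) 1) s K).submatrix id p =
      fromBlocks 1 0 (Matrix.of fun j i => K (σ (Sum.inl i)) j)
        (Matrix.of (Sum.elim s fun k => K (σ (Sum.inr k))))ᵀ := by
    ext x y
    rcases x with i | j <;> rcases y with i' | b | k
    · simp [bordered, hp₁, hrow, Pi.single_apply, Matrix.one_apply, eq_comm]
    · simp [bordered, hp₂, borderRow]
    · simp [bordered, hp₃, hrow]
    · simp [bordered, hp₁, hcore]
    · simp [bordered, hp₂, coreRow]
    · simp [bordered, hp₃, hcore]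
  have h := det_permute' p (bordered (fun i => Pi.single (σ (Sum.inl i)) (1 : 𝕜)) s K)
  rw [hN, det_fromBlocks_zero₁₂, det_one, one_mul, det_transpose, hsign] at h
  rw [h, ← mul_assoc, ← Int.cast_mul, ← Units.val_mul, Int.units_mul_self]
  simp

theorem det_eq_sum_sign_prod_row {n : Type*} [Fintype n] [DecidableEq n] (A : Matrix n n 𝕜) :
    A.det = ∑ σ : Perm n, ((Perm.sign σ : ℤ) : 𝕜) * ∏ i, A i (σ i) := by
  rw [← det_transpose, det_apply']
  rfl

/-- The algebraic core of the Andréief identity. -/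
theorem sum_sum_perm_eq_factorial_mul_det_bordered (r : α → α ⊕ κ → 𝕜)
    (s : β → β ⊕ κ → 𝕜) (K : α ⊕ κ → β ⊕ κ → 𝕜) :
    ∑ σ : Perm (α ⊕ κ), ∑ τ : Perm (β ⊕ κ),
      (((Perm.sign σ : ℤ) : 𝕜) * ∏ i, r i (σ (Sum.inl i))) *
        (((Perm.sign τ : ℤ) : 𝕜) * ∏ i, s i (τ (Sum.inl i))) *
        ∏ k, K (σ (Sum.inr k)) (τ (Sum.inr k)) =
      (Fintype.card κ).factorial * (bordered r s K).det := by
  rw [det_bordered_eq_sum, ← nsmul_eq_mul, ← sum_perm_comp_inl (fun f : α → α ⊕ κ =>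
    (∏ i, r i (f i)) * (bordered (fun i => Pi.single (f i) 1) s K).det)
    fun f hf => by rw [det_bordered_single_of_not_injective f hf, mul_zero]]
  refine Finset.sum_congr rfl fun σ _ => ?_
  simp only [Function.comp_apply]
  rw [det_bordered_single, det_eq_sum_sign_prod_row, Finset.mul_sum, Finset.mul_sum]
  refine Finset.sum_congr rfl fun τ _ => ?_
  simp only [Fintype.prod_sum_type, Matrix.of_apply, Sum.elim_inl, Sum.elim_inr]
  ring

end Bordered

/-- The generalized Andréief identity with border and variables indexed by finite types. -/
theorem integral_det_mul_det_eq_det_bordered {α β κ Ω 𝕜 : Type*} [RCLike 𝕜] [Fintype α]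
    [Fintype β] [Fintype κ] [DecidableEq α] [DecidableEq β] [DecidableEq κ]
    [MeasurableSpace Ω] (μ : Measure Ω) [SigmaFinite μ]
    (r : α → α ⊕ κ → 𝕜) (s : β → β ⊕ κ → 𝕜) (R : α ⊕ κ → Ω → 𝕜) (S : β ⊕ κ → Ω → 𝕜)
    (hRS : ∀ i j, Integrable (fun w => R i w * S j w) μ) :
    ∫ v : κ → Ω, (Matrix.of (Sum.elim r fun k j => R j (v k))).det *
        (Matrix.of (Sum.elim s fun k j => S j (v k))).det ∂(Measure.pi fun _ => μ) =
      (Fintype.card κ).factorial *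
        (bordered r s fun i j => ∫ w, R i w * S j w ∂μ).det := by
  have hexp (v : κ → Ω) : (Matrix.of (Sum.elim r fun k j => R j (v k))).det *
      (Matrix.of (Sum.elim s fun k j => S j (v k))).det =
      ∑ σ : Perm (α ⊕ κ), ∑ τ : Perm (β ⊕ κ),
        (((Perm.sign σ : ℤ) : 𝕜) * ∏ i, r i (σ (Sum.inl i))) *
        (((Perm.sign τ : ℤ) : 𝕜) * ∏ i, s i (τ (Sum.inl i))) *
        ∏ k, (R (σ (Sum.inr k)) (v k) * S (τ (Sum.inr k)) (v k)) := by
    rw [det_eq_sum_sign_prod_row, det_eq_sum_sign_prod_row, Finset.sum_mul_sum]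
    refine Finset.sum_congr rfl fun σ _ => Finset.sum_congr rfl fun τ _ => ?_
    simp only [Fintype.prod_sum_type, Matrix.of_apply, Sum.elim_inl, Sum.elim_inr,
      Finset.prod_mul_distrib]
    ring
  have hint (σ : Perm (α ⊕ κ)) (τ : Perm (β ⊕ κ)) : Integrable (fun v : κ → Ω =>
      (((Perm.sign σ : ℤ) : 𝕜) * ∏ i, r i (σ (Sum.inl i))) *
        (((Perm.sign τ : ℤ) : 𝕜) * ∏ i, s i (τ (Sum.inl i))) *
        ∏ k, (R (σ (Sum.inr k)) (v k) * S (τ (Sum.inr k)) (v k)))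
      (Measure.pi fun _ => μ) :=
    (Integrable.fintype_prod (f := fun k w => R (σ (Sum.inr k)) w * S (τ (Sum.inr k)) w)
      fun k => hRS _ _).const_mul _
  simp_rw [hexp]
  rw [integral_finsetSum _ fun σ _ => integrable_finsetSum _ fun τ _ => hint σ τ,
    ← sum_sum_perm_eq_factorial_mul_det_bordered]
  refine Finset.sum_congr rfl fun σ _ => ?_
  rw [integral_finsetSum _ fun τ _ => hint σ τ]
  refine Finset.sum_congr rfl fun τ _ => ?_
  rw [integral_const_mul, integral_fintype_prod_eq_prod
    (f := fun k w => R (σ (Sum.inr k)) w * S (τ (Sum.inr k)) w)]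

theorem val_finRotate_pow (n k : ℕ) (v : Fin n) :
    ((finRotate n ^ k) v : ℕ) = (v + k) % n := by
  induction k with
  | zero => simp [Nat.mod_eq_of_lt v.2]
  | succ k ih =>
    have := v.neZero
    rw [pow_succ', Perm.mul_apply, finRotate_apply, Fin.val_add, ih, Fin.val_one']
    simp [add_assoc]

/-- The sign of the permutation exchanging two adjacent blocks of lengths `a` and `b`. -/
theorem sign_of_block_exchange {a b n : ℕ} (hn : a + b ≤ n) (p : Perm (Fin n))
    (hp : ∀ v : Fin n, (p v : ℕ) = if (v : ℕ) < a then v + b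
      else if (v : ℕ) < a + b then v - a else v) :
    Perm.sign p = (-1) ^ (a * b) := by
  obtain ⟨L, rfl⟩ := Nat.exists_eq_add_of_le hn
  have hpe : p = finSumFinEquiv.permCongr
      (Equiv.Perm.sumCongr (finRotate (a + b) ^ b) (1 : Perm (Fin L))) := by
    ext v
    obtain ⟨w, rfl⟩ := finSumFinEquiv.surjective v
    rw [hp, Equiv.permCongr_apply, Equiv.symm_apply_apply]
    rcases w with w | w
    · have hw := w.2
      simp only [Equiv.Perm.sumCongr_apply, Sum.map_inl, finSumFinEquiv_apply_left,
        Fin.val_castAdd, val_finRotate_pow, hw, if_true]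
      split_ifs with h
      · rw [Nat.mod_eq_of_lt (by omega)]
      · rw [show (w : ℕ) + b = w - a + (a + b) by omega, Nat.add_mod_right,
          Nat.mod_eq_of_lt (by omega)]
    · simp
      omega
  rw [hpe, Perm.sign_permCongr, Perm.sign_sumCongr, map_pow, sign_finRotate, ← pow_mul,
    Perm.sign_one, mul_one]
  rcases b with - | b
  · simp
  · rw [show a + (b + 1) - 1 = a + b by omega, add_mul, pow_add,
      (Nat.even_mul_succ_self b).neg_one_pow, mul_one]

/-- `Fin (n + m)` split into its first `m` and its last `n` elements. -/
def finSumEquiv (m n : ℕ) : Fin m ⊕ Fin n ≃ Fin (n + m) :=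
  finSumFinEquiv.trans (finCongr (Nat.add_comm m n))

@[simp]
theorem val_finSumEquiv_inl (m n : ℕ) (i : Fin m) :
    (finSumEquiv m n (Sum.inl i) : ℕ) = i := by
  simp [finSumEquiv]

@[simp]
theorem val_finSumEquiv_inr (m n : ℕ) (i : Fin n) :
    (finSumEquiv m n (Sum.inr i) : ℕ) = m + i := by
  simp [finSumEquiv, Nat.add_comm]

theorem det_eq_det_sumElim {𝕜 : Type*} [CommRing 𝕜] {a L : ℕ}
    {M : Matrix (Fin (L + a)) (Fin (L + a)) 𝕜} {r : Fin a → Fin (L + a) → 𝕜}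
    {A : Fin L → Fin (L + a) → 𝕜} (hr : ∀ i j, M (finSumEquiv a L (Sum.inl i)) j = r i j)
    (hA : ∀ k j, M (finSumEquiv a L (Sum.inr k)) j = A k j) :
    M.det = (Matrix.of (Sum.elim (fun i j => r i (finSumEquiv a L j))
      fun k j => A k (finSumEquiv a L j))).det := by
  rw [← det_submatrix_equiv_self (finSumEquiv a L)]
  congr 1
  ext x y
  rcases x with x | x
  · exact hr _ _
  · exact hA _ _

/-- Bringing a bordered matrix in block form to the arrangement of `bordered` costs the sign
of a block exchange. -/
theorem det_eq_neg_one_pow_mul_det_bordered {𝕜 : Type*} [CommRing 𝕜] {L a b : ℕ}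
    {M : Matrix (Fin (L + a + b)) (Fin (L + a + b)) 𝕜}
    {r : Fin a → Fin (L + a) → 𝕜} {s : Fin b → Fin (L + b) → 𝕜}
    {K : Fin (L + a) → Fin (L + b) → 𝕜}
    (h0 : ∀ (u v : Fin (L + a + b)) (i : Fin b) (j : Fin a),
      (u : ℕ) = i → (v : ℕ) = j → M u v = 0)
    (hs : ∀ (u v : Fin (L + a + b)) (i : Fin b) (j : Fin (L + b)),
      (u : ℕ) = i → (v : ℕ) = a + j → M u v = s i j)
    (hr : ∀ (u v : Fin (L + a + b)) (i : Fin (L + a)) (j : Fin a),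
      (u : ℕ) = b + i → (v : ℕ) = j → M u v = r j i)
    (hK : ∀ (u v : Fin (L + a + b)) (i : Fin (L + a)) (j : Fin (L + b)),
      (u : ℕ) = b + i → (v : ℕ) = a + j →
      M u v = K i j) :
    M.det = (-1) ^ (a * b) * (bordered (fun i j => r i (finSumEquiv a L j))
      (fun i j => s i (finSumEquiv b L j))
      fun i j => K (finSumEquiv a L i) (finSumEquiv b L j)).det := by
  let C : Fin a ⊕ (Fin b ⊕ Fin L) ≃ Fin (L + a + b) :=
    ((Equiv.sumCongr (Equiv.refl _) (finSumEquiv b L)).trans (finSumEquiv a (L + b))).trans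
      (finCongr (by omega))
  let B : Fin a ⊕ (Fin b ⊕ Fin L) ≃ Fin (L + a + b) :=
    (Equiv.sumAssoc _ _ _).symm.trans <|
      ((Equiv.sumCongr (Equiv.sumComm _ _) (Equiv.refl _)).trans (Equiv.sumAssoc _ _ _)).trans <|
      (Equiv.sumCongr (Equiv.refl _) (finSumEquiv a L)).trans (finSumEquiv b (L + a))
  have hC₁ (i : Fin a) : (C (Sum.inl i) : ℕ) = i := by simp [C]
  have hC₂ (j : Fin b ⊕ Fin L) : (C (Sum.inr j) : ℕ) = a + finSumEquiv b L j := by simp [C]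
  have hB₁ (i : Fin a) : (B (Sum.inl i) : ℕ) = b + i := by simp [B]
  have hB₂ (j : Fin b) : (B (Sum.inr (Sum.inl j)) : ℕ) = j := by simp [B]
  have hB₃ (k : Fin L) : (B (Sum.inr (Sum.inr k)) : ℕ) = b + (a + k) := by simp [B]
  have hsign : Perm.sign (C.symm.trans B) = (-1) ^ (a * b) := by
    refine sign_of_block_exchange (by omega) _ fun v => ?_
    obtain ⟨x, rfl⟩ := C.surjective v
    rw [Equiv.trans_apply, Equiv.symm_apply_apply]
    rcases x with i | j | k
    · simp [hC₁, hB₁, Nat.add_comm]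
    · simp [hC₂, hB₂]
    · simp only [hC₂, hB₃, val_finSumEquiv_inr]
      split_ifs <;> omega
  have hN : (Mᵀ.submatrix id (C.symm.trans B)).submatrix C C =
      bordered (fun i j => r i (finSumEquiv a L j)) (fun i j => s i (finSumEquiv b L j))
        fun i j => K (finSumEquiv a L i) (finSumEquiv b L j) := by
    ext x y
    simp only [submatrix_apply, id, Equiv.trans_apply, Equiv.symm_apply_apply, transpose_apply]
    rcases x with i | j <;> rcases y with i' | j' | k'
    · exact hr _ _ (finSumEquiv a L (Sum.inl i')) i (by simp [hB₁]) (hC₁ i)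
    · exact h0 _ _ _ _ (hB₂ j') (hC₁ i)
    · exact hr _ _ (finSumEquiv a L (Sum.inr k')) i (by simp [hB₃]) (hC₁ i)
    · exact hK _ _ (finSumEquiv a L (Sum.inl i')) _ (by simp [hB₁]) (hC₂ j)
    · exact hs _ _ _ _ (hB₂ j') (hC₂ j)
    · exact hK _ _ (finSumEquiv a L (Sum.inr k')) _ (by simp [hB₃]) (hC₂ j)
  rw [← hN, det_submatrix_equiv_self, det_permute', hsign, det_transpose]
  simp [← mul_assoc, ← mul_pow]

/-- Lemma 2 (generalized Andréief integral identity of Kieburg and Guhr). -/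
theorem generalized_andreief
    (L a b : ℕ) (hL : 1 ≤ L)
    (r : Fin a → Fin (L + a) → ℂ) (s : Fin b → Fin (L + b) → ℂ)
    (R : Fin (L + a) → ℂ → ℂ) (S : Fin (L + b) → ℂ → ℂ)
    (hR : ∀ i, Measurable (R i)) (hS : ∀ j, Measurable (S j))
    (hRS : ∀ i j, Integrable (fun w : ℂ => R i w * S j w) volume)
    (hJ : Integrable
      (fun v : Fin L → ℂ =>
        Matrix.det (Matrix.of fun i j : Fin (L + a) =>
            if h : (i : ℕ) < a then r ⟨i, h⟩ j
            else R j (v ⟨(i : ℕ) - a, by have := i.2; omega⟩)) *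
        Matrix.det (Matrix.of fun i j : Fin (L + b) =>
            if h : (i : ℕ) < b then s ⟨i, h⟩ j
            else S j (v ⟨(i : ℕ) - b, by have := i.2; omega⟩)))
      (Measure.pi fun _ : Fin L => (volume : Measure ℂ))) :
    (∫ v : Fin L → ℂ,
        Matrix.det (Matrix.of fun i j : Fin (L + a) =>
            if h : (i : ℕ) < a then r ⟨i, h⟩ j
            else R j (v ⟨(i : ℕ) - a, by have := i.2; omega⟩)) *
        Matrix.det (Matrix.of fun i j : Fin (L + b) =>
            if h : (i : ℕ) < b then s ⟨i, h⟩ j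
            else S j (v ⟨(i : ℕ) - b, by have := i.2; omega⟩))
        ∂(Measure.pi fun _ : Fin L => (volume : Measure ℂ))) =
      (-1 : ℂ) ^ (a * b) * (L.factorial : ℂ) *
        Matrix.det (Matrix.of fun u v : Fin (L + a + b) =>
          if hu : (u : ℕ) < b then
            (if hv : (v : ℕ) < a then 0
             else s ⟨u, hu⟩ ⟨(v : ℕ) - a, by have := v.2; omega⟩)
          else
            (if hv : (v : ℕ) < a then
              r ⟨v, hv⟩ ⟨(u : ℕ) - b, by have := u.2; omega⟩
             else
              ∫ w : ℂ, R ⟨(u : ℕ) - b, by have := u.2; omega⟩ w *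
                S ⟨(v : ℕ) - a, by have := v.2; omega⟩ w)) := by
  rw [det_eq_neg_one_pow_mul_det_bordered (r := r) (s := s)
    (K := fun i j => ∫ w : ℂ, R i w * S j w)
    (fun u v i j hu hv => by simp [hu, hv]) (fun u v i j hu hv => by simp [hu, hv])
    (fun u v i j hu hv => by simp [hu, hv]) (fun u v i j hu hv => by simp [hu, hv])]
  refine (integral_congr_ae (.of_forall fun v : Fin L → ℂ => congrArg₂ (· * ·)
    (det_eq_det_sumElim (r := r) (A := fun k j => R j (v k))
      (fun i j => by simp) (fun k j => by simp))
    (det_eq_det_sumElim (r := s) (A := fun k j => S j (v k))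
      (fun i j => by simp) (fun k j => by simp)))).trans ?_
  rw [integral_det_mul_det_eq_det_bordered volume _ _ (fun i => R (finSumEquiv a L i))
    (fun j => S (finSumEquiv b L j)) fun i j => hRS _ _, Fintype.card_fin,
    mul_mul_mul_comm, ← mul_pow, neg_one_mul, neg_neg, one_pow, one_mul]

end
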